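/- arXiv:1010.5552 — 2 statements merged into one kernel-verified Lean document; each statement's English description precedes it below -/
import Mathlib

section
/- Let d ≥ 1, let G̃ = (I,P;E) be a pinned graph and p a configuration with (G̃,p) pinned d-isostatic, and let v ∈ I be an inner vertex incident to exactly d edges of E. Then (G̃ − v, p) is pinned d-isostatic, where G̃ − v = (I ∖ {v}, P; E_v) and E_v is the set of edges of E not incident to v; i.e., |E_v| = d|I ∖ {v}| and R(G̃ − v, p) is invertible. -/
open Matrix

/-- A pinned graph: the vertex set `V` is partitioned into inner and pinned vertices,
and each edge is an unordered pair of distinct vertices with at least one inner endpoint. -/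
structure PinnedGraph (V : Type) [Fintype V] [DecidableEq V] where
  inner : Finset V
  pinned : Finset V
  disj : Disjoint inner pinned
  cover : inner ∪ pinned = Finset.univ
  edges : Finset (Sym2 V)
  loopless : ∀ e ∈ edges, ¬ e.IsDiag
  edge_inner : ∀ e ∈ edges, ∃ v, v ∈ e ∧ v ∈ inner

variable {V : Type} [Fintype V] [DecidableEq V]

/-- The pinned rigidity matrix in dimension `d`, with rows indexed by the edge set `E'`
and a block of `d` columns for each vertex of the inner-vertex set `I'`:  in the row of
edge `{u,v}` the block of an endpoint `u ∈ I'` is `p u - p v`, and all other blocks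
are zero. -/
noncomputable def rMatrix (d : ℕ) (p : V → EuclideanSpace ℝ (Fin d))
    (I' : Finset V) (E' : Finset (Sym2 V)) :
    Matrix {e // e ∈ E'} ({i // i ∈ I'} × Fin d) ℝ :=
  Matrix.of fun e ik =>
    if h : (ik.1 : V) ∈ (e : Sym2 V) then (p ik.1 - p (Sym2.Mem.other' h)) ik.2
    else 0

/-- A matrix has trivial kernel; for a square matrix this is invertibility. -/
def KernelTrivial {m n : Type} [Fintype n] (M : Matrix m n ℝ) : Prop :=
  ∀ U : n → ℝ, M.mulVec U = 0 → U = 0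

/-- The pinned graph with inner vertices `I'` and edges `E'` is pinned `d`-isostatic at the
configuration `p` : the edge count is `d|I'|` and the pinned rigidity matrix is invertible. -/
def IsostaticAt (d : ℕ) (p : V → EuclideanSpace ℝ (Fin d))
    (I' : Finset V) (E' : Finset (Sym2 V)) : Prop :=
  E'.card = d * I'.card ∧ KernelTrivial (rMatrix d p I' E')

/-- `(I',P';E')` is a subgraph of the pinned graph `G`. -/
structure IsSubgraph (G : PinnedGraph V) (I' P' : Finset V) (E' : Finset (Sym2 V)) : Prop where
  inner_sub : I' ⊆ G.inner
  pinned_sub : P' ⊆ G.pinned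
  edges_sub : E' ⊆ G.edges
  endpoints : ∀ e ∈ E', ∀ v ∈ e, v ∈ I' ∪ P'
  edge_inner : ∀ e ∈ E', ∃ v, v ∈ e ∧ v ∈ I'

/-- A `d`-Assur graph: a pinned `d`-isostatic graph with no proper pinned `d`-isostatic
subgraph having a nonempty inner-vertex set. -/
def IsAssur (d : ℕ) (G : PinnedGraph V) : Prop :=
  (∃ p, IsostaticAt d p G.inner G.edges) ∧
  ∀ I' P' E', IsSubgraph G I' P' E' → I'.Nonempty → E' ≠ G.edges →
    ¬ ∃ p, IsostaticAt d p I' E'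

/-- An orientation of the edges of a pinned graph: each edge is assigned an initial vertex. -/
structure GOrient (G : PinnedGraph V) where
  init : {e // e ∈ G.edges} → V
  init_mem : ∀ e, init e ∈ Subtype.val e

/-- The terminal vertex of an edge under an orientation. -/
noncomputable def GOrient.term {G : PinnedGraph V} (O : GOrient G)
    (e : {e // e ∈ G.edges}) : V :=
  Sym2.Mem.other' (O.init_mem e)

/-- The out-degree of a vertex under an orientation. -/
def GOrient.outDeg {G : PinnedGraph V} (O : GOrient G) (v : V) : ℕ :=
  (Finset.univ.filter fun e => O.init e = v).card

/-- A `d`-directed orientation: every inner vertex has out-degree `d` and every pinned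
vertex has out-degree `0`. -/
def IsDDirected (d : ℕ) {G : PinnedGraph V} (O : GOrient G) : Prop :=
  (∀ v ∈ G.inner, O.outDeg v = d) ∧ ∀ v ∈ G.pinned, O.outDeg v = 0

/-- A strongly `d`-Assur graph: a `d`-Assur graph such that on a dense open set of
configurations, deleting the row of any edge from the pinned rigidity matrix leaves a
matrix with a kernel vector that is nonzero at every inner vertex. -/
def IsStronglyAssur (d : ℕ) (G : PinnedGraph V) : Prop :=
  IsAssur d G ∧
  ∃ S : Set (V → EuclideanSpace ℝ (Fin d)), IsOpen S ∧ Dense S ∧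
    ∀ p ∈ S, ∀ e ∈ G.edges,
      ∃ U : {i // i ∈ G.inner} → EuclideanSpace ℝ (Fin d),
        (∀ i, U i ≠ 0) ∧
        (rMatrix d p G.inner (G.edges.erase e)).mulVec (fun ik => U ik.1 ik.2) = 0

theorem kernelTrivial_iff_surj {m n : Type} [Fintype m] [Fintype n] (M : Matrix m n ℝ)
    (h : Fintype.card m = Fintype.card n) :
    KernelTrivial M ↔ Function.Surjective M.mulVec := by
  have h1 : Function.Injective M.mulVecLin ↔ Function.Surjective M.mulVecLin :=
    LinearMap.injective_iff_surjective_of_finrank_eq_finrank (by simp [h])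
  have h2 : KernelTrivial M ↔ Function.Injective M.mulVecLin := by
    rw [injective_iff_map_eq_zero]
    rfl
  rw [h2, h1]
  rfl

theorem rMatrix_mulVec_restrict {V : Type} [Fintype V] [DecidableEq V] (d : ℕ)
    (p : V → EuclideanSpace ℝ (Fin d)) (I' : Finset V) (E' : Finset (Sym2 V))
    (u : V → Fin d → ℝ) (e : {e // e ∈ E'}) :
    (rMatrix d p I' E').mulVec (fun ik => u ik.1 ik.2) e =
      ∑ i ∈ I', ∑ k, (if h : i ∈ (e : Sym2 V) then (p i - p (Sym2.Mem.other' h)) k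
        else 0) * u i k := by
  rw [← Finset.sum_coe_sort]
  simp only [Matrix.mulVec, dotProduct, rMatrix, Matrix.of_apply]
  rw [Fintype.sum_prod_type]

/-- If `(G,p)` is pinned `d`-isostatic and `v` is an inner vertex incident
to exactly `d` edges, then `(G - v, p)` is pinned `d`-isostatic: `|E_v| = d|I \ {v}|`
and its pinned rigidity matrix is invertible. -/
theorem stmt17 {V : Type} [Fintype V] [DecidableEq V] (d : ℕ) (hd : 1 ≤ d)
    (G : PinnedGraph V) (p : V → EuclideanSpace ℝ (Fin d))
    (hiso : IsostaticAt d p G.inner G.edges)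
    (v : V) (hv : v ∈ G.inner)
    (hdeg : (G.edges.filter fun e => v ∈ e).card = d) :
    IsostaticAt d p (G.inner.erase v) (G.edges.filter fun e => ¬ v ∈ e) := by
  obtain ⟨hc, hk⟩ := hiso
  have hcard : (G.edges.filter fun e => ¬ v ∈ e).card = d * (G.inner.erase v).card := by
    have h1 := Finset.card_filter_add_card_filter_not (s := G.edges) (fun e => v ∈ e)
    have h2 := Finset.card_erase_add_one hv
    rw [hc, ← h2, hdeg, mul_add, mul_one] at h1
    omega
  refine ⟨hcard, ?_⟩
  rw [kernelTrivial_iff_surj _ (by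
    rw [Fintype.card_prod, Fintype.card_coe, Fintype.card_coe, Fintype.card_fin, hcard, mul_comm])]
  rw [kernelTrivial_iff_surj _ (by
    rw [Fintype.card_prod, Fintype.card_coe, Fintype.card_coe, Fintype.card_fin, hc, mul_comm])] at hk
  intro w
  obtain ⟨U, hU⟩ := hk (fun e => if h : ¬ v ∈ (e : Sym2 V) then
    w ⟨e, Finset.mem_filter.2 ⟨e.2, h⟩⟩ else 0)
  set u : V → Fin d → ℝ := fun i k => if h : i ∈ G.inner then U (⟨i, h⟩, k) else 0 with hu
  have hUu : U = fun ik => u ik.1 ik.2 := by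
    funext ⟨i, k⟩
    simp [hu]
  refine ⟨fun ik => u ik.1 ik.2, ?_⟩
  funext e
  obtain ⟨he, hve⟩ := Finset.mem_filter.1 e.2
  have h3 := congrFun hU ⟨e, he⟩
  rw [hUu, rMatrix_mulVec_restrict] at h3
  rw [rMatrix_mulVec_restrict, Finset.sum_erase]
  · rw [h3]
    simp [hve]
  · simp [hve]
end

section
/- Let d ≥ 1 and let G̃ = (I,P;E) be a d-Assur graph with |I| ≥ 2. Then every inner vertex of G̃ is incident to at least d + 1 edges of E. -/
open Matrix

variable {V : Type} [Fintype V] [DecidableEq V]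

/-- entries of the rigidity matrix, as a total function -/
noncomputable def rEnt (d : ℕ) (p : V → EuclideanSpace ℝ (Fin d)) (e : Sym2 V) (i : V)
    (k : Fin d) : ℝ :=
  if h : i ∈ e then (p i - p (Sym2.Mem.other' h)) k else 0

lemma rEnt_eq_zero (d : ℕ) (p : V → EuclideanSpace ℝ (Fin d)) (e : Sym2 V) (i : V)
    (k : Fin d) (h : i ∉ e) : rEnt d p e i k = 0 := by
  simp [rEnt, h]

lemma mulVec_rMatrix (d : ℕ) (p : V → EuclideanSpace ℝ (Fin d)) (I' : Finset V)
    (E' : Finset (Sym2 V)) (W : V → Fin d → ℝ) (e : {e // e ∈ E'}) :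
    (rMatrix d p I' E').mulVec (fun ik => W ik.1 ik.2) e
      = ∑ i ∈ I', ∑ k, rEnt d p e i k * W i k := by
  rw [← Finset.sum_coe_sort I' (fun i => ∑ k, rEnt d p e i k * W i k)]
  simp only [Matrix.mulVec, dotProduct, Fintype.sum_prod_type]
  rfl

lemma kernelTrivial_iff (d : ℕ) (p : V → EuclideanSpace ℝ (Fin d)) (I' : Finset V)
    (E' : Finset (Sym2 V)) :
    KernelTrivial (rMatrix d p I' E') ↔
      ∀ W : V → Fin d → ℝ, (∀ e ∈ E', ∑ i ∈ I', ∑ k, rEnt d p e i k * W i k = 0) →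
        ∀ i ∈ I', W i = 0 := by
  constructor
  · intro h W hW i hi
    have := h (fun ik => W ik.1 ik.2) (by
      funext e
      rw [mulVec_rMatrix]
      exact hW e e.2)
    funext k
    exact congrFun this (⟨i, hi⟩, k)
  · intro h U hU
    set W : V → Fin d → ℝ := fun i k => if hi : i ∈ I' then U (⟨i, hi⟩, k) else 0 with hWdef
    have hUW : U = fun ik => W ik.1 ik.2 := by
      funext ik
      simp [hWdef]
    have := h W (fun e he => by
      rw [← mulVec_rMatrix d p I' E' W ⟨e, he⟩, ← hUW, hU]; rfl)
    rw [hUW]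
    funext ik
    exact congrFun (this ik.1 ik.1.2) ik.2

/-- In a `d`-Assur graph with at least two inner vertices, every inner
vertex is incident to at least `d + 1` edges. -/
theorem stmt18 {V : Type} [Fintype V] [DecidableEq V] (d : ℕ) (hd : 1 ≤ d)
    (G : PinnedGraph V) (hG : IsAssur d G) (hI : 2 ≤ G.inner.card) :
    ∀ v ∈ G.inner, d + 1 ≤ (G.edges.filter fun e => v ∈ e).card := by
  intro v hv
  obtain ⟨⟨p, hcard, hker⟩, hmin⟩ := hG
  rw [kernelTrivial_iff] at hker
  set F := G.edges.filter fun e => v ∈ e with hF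
  let M : Matrix {e // e ∈ F} (Fin d) ℝ := Matrix.of fun e k => rEnt d p e v k
  have hinj : Function.Injective M.mulVecLin := by
    rw [injective_iff_map_eq_zero]
    intro x hx
    have key := hker (fun i k => if i = v then x k else 0) (by
      intro e he
      rw [Finset.sum_eq_single v]
      · by_cases hve : v ∈ e
        · have := congrFun hx ⟨e, by simp [hF, he, hve]⟩
          simpa [M, Matrix.mulVec, dotProduct] using this
        · simp [rEnt_eq_zero d p e v _ hve]
      · intro b _ hb
        simp [hb]
      · intro h; exact absurd hv h) v hv
    simpa using key
  by_contra hlt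
  have hle : d ≤ F.card := by
    have := LinearMap.finrank_le_finrank_of_injective hinj
    simpa using this
  have hFd : F.card = d := by omega
  have hsurj : Function.Surjective M.mulVecLin :=
    (LinearMap.injective_iff_surjective_of_finrank_eq_finrank (by simp [hFd])).1 hinj
  have hsplit : F.card + (G.edges.filter fun e => v ∉ e).card = G.edges.card :=
    Finset.card_filter_add_card_filter_not _
  have hIc : (G.inner.erase v).card + 1 = G.inner.card := Finset.card_erase_add_one hv
  refine hmin (G.inner.erase v) G.pinned (G.edges.filter fun e => v ∉ e)
    ⟨Finset.erase_subset _ _, subset_rfl, Finset.filter_subset _ _, ?_, ?_⟩ ?_ ?_ ⟨p, ?_, ?_⟩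
  · intro e he w hw
    have hwv : w ≠ v := by
      rintro rfl
      exact (Finset.mem_filter.1 he).2 hw
    have := Finset.mem_univ w
    rw [← G.cover] at this
    simp only [Finset.mem_union, Finset.mem_erase] at this ⊢
    tauto
  · intro e he
    obtain ⟨he1, he2⟩ := Finset.mem_filter.1 he
    obtain ⟨w, hw, hwI⟩ := G.edge_inner e he1
    refine ⟨w, hw, Finset.mem_erase.2 ⟨?_, hwI⟩⟩
    rintro rfl
    exact he2 hw
  · rw [← Finset.card_pos]; omega
  · intro h
    rw [h] at hsplit
    omega
  · rw [← hIc, mul_add] at hcard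
    omega
  · rw [kernelTrivial_iff]
    intro W hW i hi
    obtain ⟨x, hx⟩ := hsurj
      (fun e => - ∑ i ∈ G.inner.erase v, ∑ k, rEnt d p e i k * W i k)
    have hsame : ∀ e : Sym2 V, ∑ i ∈ G.inner.erase v, ∑ k, rEnt d p e i k *
        (if i = v then x k else W i k)
        = ∑ i ∈ G.inner.erase v, ∑ k, rEnt d p e i k * W i k := by
      intro e
      refine Finset.sum_congr rfl fun j hj => ?_
      simp [Finset.ne_of_mem_erase hj]
    have key := hker (fun i k => if i = v then x k else W i k) (by
      intro e he
      rw [← Finset.add_sum_erase _ _ hv, hsame]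
      by_cases hve : v ∈ e
      · have := congrFun hx ⟨e, by simp [hF, he, hve]⟩
        simp only [M, Matrix.mulVecLin_apply, Matrix.mulVec, dotProduct, Matrix.of_apply] at this
        simp only [if_true]
        rw [this]
        simp
      · rw [hW e (by simp [he, hve])]
        simp [rEnt_eq_zero d p e v _ hve]) i (Finset.mem_of_mem_erase hi)
    simpa [Finset.ne_of_mem_erase hi] using key
end
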